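/- arXiv:1911.06139 — 2 statements merged into one kernel-verified Lean document; each statement's English description precedes it below -/
import Mathlib

section
/- Let A be a real n×n matrix with constant row sums, let α ∈ ℝ, let J be the n×n all-ones matrix, and let p ∈ [1,∞]. Then for every positive integer k, τ_p((A + αJ)^k) = τ_p(A^k). -/
open Matrix Polynomial Filter
open scoped ENNReal

/-- The `l_p` norm of a vector in `ℝⁿ`, for `p ∈ [0,∞]`. -/
noncomputable def lpNorm (p : ℝ≥0∞) {n : ℕ} (x : Fin n → ℝ) : ℝ :=
  ‖(WithLp.equiv p (Fin n → ℝ)).symm x‖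

/-- The vector-norm based ergodicity coefficient `τ_p(A)`. -/
noncomputable def tau (p : ℝ≥0∞) {n : ℕ} (A : Matrix (Fin n) (Fin n) ℝ) : ℝ :=
  sSup {y : ℝ | ∃ x : Fin n → ℝ, (∑ i, x i) = 0 ∧ lpNorm p x = 1 ∧ y = lpNorm p (Aᵀ *ᵥ x)}

/-- The all-ones matrix `J`. -/
def allOnes (n : ℕ) : Matrix (Fin n) (Fin n) ℝ := Matrix.of fun _ _ => 1

/-- The transpose of a matrix with constant row sums preserves the hyperplane of vectors whose
entries sum to zero. -/
theorem sum_transpose_mulVec_eq_zero {n : ℕ} {A : Matrix (Fin n) (Fin n) ℝ} {c : ℝ}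
    (hrow : ∀ i, ∑ j, A i j = c) {x : Fin n → ℝ} (hx : ∑ i, x i = 0) :
    ∑ i, (Aᵀ *ᵥ x) i = 0 := by
  simp only [mulVec, dotProduct, transpose_apply]
  rw [Finset.sum_comm]
  simp only [← Finset.sum_mul, hrow, ← Finset.mul_sum, hx, mul_zero]

/-- Adding a multiple of the all-ones matrix does not change the action of the transpose on vectors
whose entries sum to zero. -/
theorem transpose_add_smul_allOnes_mulVec {n : ℕ} (A : Matrix (Fin n) (Fin n) ℝ) (α : ℝ)
    {x : Fin n → ℝ} (hx : ∑ i, x i = 0) :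
    (A + α • allOnes n)ᵀ *ᵥ x = Aᵀ *ᵥ x := by
  ext i
  simp [mulVec, dotProduct, allOnes, add_mul, Finset.sum_add_distrib, ← Finset.mul_sum, hx]

theorem transpose_pow_add_smul_allOnes_mulVec {n : ℕ} {A : Matrix (Fin n) (Fin n) ℝ} {c : ℝ}
    (hrow : ∀ i, ∑ j, A i j = c) (α : ℝ) (k : ℕ) {x : Fin n → ℝ} (hx : ∑ i, x i = 0) :
    ((A + α • allOnes n) ^ k)ᵀ *ᵥ x = (A ^ k)ᵀ *ᵥ x := by
  induction k generalizing x with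
  | zero => simp
  | succ k ih =>
    rw [pow_succ', pow_succ', transpose_mul, transpose_mul, ← mulVec_mulVec, ← mulVec_mulVec,
      transpose_add_smul_allOnes_mulVec A α hx, ih (sum_transpose_mulVec_eq_zero hrow hx)]

/-- `τ_p((A + αJ)^k) = τ_p(A^k)` for every e-matrix A (Lemma 2.19). -/
theorem tau_pow_add_smul_allOnes {n : ℕ} (A : Matrix (Fin n) (Fin n) ℝ) (c : ℝ)
    (hrow : ∀ i, ∑ j, A i j = c) (α : ℝ) (p : ℝ≥0∞) (hp : 1 ≤ p)
    (k : ℕ) (hk : 0 < k) :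
    tau p ((A + α • allOnes n) ^ k) = tau p (A ^ k) := by
  unfold tau
  congr 1
  ext y
  refine exists_congr fun x => and_congr_right fun hx => ?_
  rw [transpose_pow_add_smul_allOnes_mulVec hrow α k hx]
end

section
/- Let G be a simple graph on n ≥ 2 vertices v_1, …, v_n with Laplacian matrix L, let d_i be the degree of v_i, and let N_i be the set of neighbors of v_i. Then τ_1(L) = max_{i ≠ j} ( d_i + d_j − |N_i ∩ N_j| ), where |N_i ∩ N_j| is the number of common neighbors of v_i and v_j. -/
open Matrix Polynomial Filter
open scoped ENNReal

theorem lpNorm_one_eq_sum_abs {n : ℕ} (x : Fin n → ℝ) : lpNorm 1 x = ∑ i, |x i| := by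
  simp [lpNorm, PiLp.norm_eq_of_L1]

/-- For a vector with zero sum, `‖Aᵀ x‖₁` is at most `‖x‖₁` times any common bound on half the
`l₁` distances between rows of `A`. -/
theorem lpNorm_one_transpose_mulVec_le {n : ℕ} (A : Matrix (Fin n) (Fin n) ℝ) {M : ℝ}
    (hM : ∀ i j, ∑ k, |A i k - A j k| ≤ 2 * M) {x : Fin n → ℝ} (hx : ∑ i, x i = 0)
    (hx1 : lpNorm 1 x = 1) : lpNorm 1 (Aᵀ *ᵥ x) ≤ M := by
  rw [lpNorm_one_eq_sum_abs] at hx1 ⊢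
  set p : Fin n → ℝ := fun i => (|x i| + x i) / 2 with hp
  set q : Fin n → ℝ := fun i => (|x i| - x i) / 2 with hq
  have hp0 : ∀ i, 0 ≤ p i := fun i => by
    have := neg_abs_le (x i)
    simp only [hp]; linarith
  have hq0 : ∀ i, 0 ≤ q i := fun i => by
    have := le_abs_self (x i)
    simp only [hq]; linarith
  have hps : ∑ i, p i = 1 / 2 := by
    simp only [hp]
    rw [← Finset.sum_div, Finset.sum_add_distrib, hx, hx1]; norm_num
  have hqs : ∑ i, q i = 1 / 2 := by
    simp only [hq]
    rw [← Finset.sum_div, Finset.sum_sub_distrib, hx, hx1]; norm_num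
  have key : ∀ k, (Aᵀ *ᵥ x) k = 2 * ∑ i, ∑ j, p i * q j * (A i k - A j k) := fun k => by
    have h1 : ∑ i, ∑ j, p i * q j * (A i k - A j k) =
        (∑ i, p i * A i k) * ∑ j, q j - (∑ i, p i) * ∑ j, q j * A j k := by
      rw [Finset.sum_mul_sum, Finset.sum_mul_sum, ← Finset.sum_sub_distrib]
      refine Finset.sum_congr rfl fun i _ => ?_
      rw [← Finset.sum_sub_distrib]
      exact Finset.sum_congr rfl fun j _ => by ring
    rw [h1, hps, hqs]
    have h2 : (Aᵀ *ᵥ x) k = ∑ i, p i * A i k - ∑ i, q i * A i k := by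
      rw [← Finset.sum_sub_distrib]
      simp only [mulVec, dotProduct, transpose_apply, hp, hq]
      exact Finset.sum_congr rfl fun i _ => by ring
    rw [h2]; ring
  calc ∑ k, |(Aᵀ *ᵥ x) k| ≤ ∑ k, 2 * ∑ i, ∑ j, p i * q j * |A i k - A j k| := by
        refine Finset.sum_le_sum fun k _ => ?_
        rw [key, abs_mul, abs_two]
        refine mul_le_mul_of_nonneg_left ?_ zero_le_two
        refine (Finset.abs_sum_le_sum_abs _ _).trans (Finset.sum_le_sum fun i _ => ?_)
        refine (Finset.abs_sum_le_sum_abs _ _).trans (Finset.sum_le_sum fun j _ => ?_)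
        rw [abs_mul, abs_of_nonneg (mul_nonneg (hp0 i) (hq0 j))]
    _ = 2 * ∑ i, ∑ j, p i * q j * ∑ k, |A i k - A j k| := by
        rw [← Finset.mul_sum, Finset.sum_comm]
        congr 1
        refine Finset.sum_congr rfl fun i _ => ?_
        rw [Finset.sum_comm]
        exact Finset.sum_congr rfl fun j _ => by rw [Finset.mul_sum]
    _ ≤ 2 * ∑ i, ∑ j, p i * q j * (2 * M) := by
        gcongr with i _ j _
        · exact mul_nonneg (hp0 i) (hq0 j)
        · exact hM i j
    _ = M := by
        simp only [← Finset.sum_mul]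
        rw [← Finset.sum_mul_sum, hps, hqs]; ring

/-- The extremal vectors `(e_i - e_j) / 2` have zero sum and unit `l₁` norm, and are mapped to half
the difference of two rows. -/
theorem exists_lpNorm_one_transpose_mulVec_eq {n : ℕ} (A : Matrix (Fin n) (Fin n) ℝ) {i j : Fin n}
    (hij : i ≠ j) : ∃ x : Fin n → ℝ, ∑ k, x k = 0 ∧ lpNorm 1 x = 1 ∧
      lpNorm 1 (Aᵀ *ᵥ x) = (∑ k, |A i k - A j k|) / 2 := by
  refine ⟨fun k => (if k = i then 1 / 2 else 0) - (if k = j then 1 / 2 else 0), ?_, ?_, ?_⟩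
  · simp [Finset.sum_sub_distrib]
  · rw [lpNorm_one_eq_sum_abs]
    have h : ∀ k, |(if k = i then (1 / 2 : ℝ) else 0) - (if k = j then 1 / 2 else 0)| =
        (if k = i then 1 / 2 else 0) + (if k = j then 1 / 2 else 0) := fun k => by
      by_cases hi : k = i
      · subst hi; simp [hij]
      · simp only [hi, if_false]; split_ifs <;> norm_num
    simp only [h, Finset.sum_add_distrib, Finset.sum_ite_eq', Finset.mem_univ, if_true]
    norm_num
  · rw [lpNorm_one_eq_sum_abs, Finset.sum_div]
    refine Finset.sum_congr rfl fun k _ => ?_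
    have h : (Aᵀ *ᵥ fun k => (if k = i then (1 / 2 : ℝ) else 0) - (if k = j then 1 / 2 else 0)) k =
        (A i k - A j k) / 2 := by
      simp only [mulVec, dotProduct, transpose_apply, mul_sub, mul_ite, mul_zero,
        Finset.sum_sub_distrib, Finset.sum_ite_eq', Finset.mem_univ, if_true]
      ring
    rw [h, abs_div, abs_two]

theorem tau_one_eq_sSup {n : ℕ} (hn : 2 ≤ n) (A : Matrix (Fin n) (Fin n) ℝ) :
    tau 1 A = sSup {y : ℝ | ∃ i j : Fin n, i ≠ j ∧ y = (∑ k, |A i k - A j k|) / 2} := by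
  set S := {y : ℝ | ∃ i j : Fin n, i ≠ j ∧ y = (∑ k, |A i k - A j k|) / 2} with hS
  have hfin : BddAbove S := by
    refine ((Set.finite_range fun ij : Fin n × Fin n =>
      (∑ k, |A ij.1 k - A ij.2 k|) / 2).subset ?_).bddAbove
    rintro _ ⟨i, j, -, rfl⟩
    exact ⟨(i, j), rfl⟩
  have hle : ∀ i j, ∑ k, |A i k - A j k| ≤ 2 * sSup S := fun i j => by
    by_cases hij : i = j
    · subst hij
      have : 0 ≤ sSup S := Real.sSup_nonneg fun y ⟨i, j, _, hy⟩ => hy ▸ by positivity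
      simpa using this
    · linarith [le_csSup hfin ⟨i, j, hij, rfl⟩]
  have hne : S.Nonempty :=
    ⟨_, ⟨0, by omega⟩, ⟨1, by omega⟩, by simp, rfl⟩
  have hsub : S ⊆ {y : ℝ | ∃ x : Fin n → ℝ, (∑ i, x i) = 0 ∧ lpNorm 1 x = 1 ∧
      y = lpNorm 1 (Aᵀ *ᵥ x)} := by
    rintro _ ⟨i, j, hij, rfl⟩
    obtain ⟨x, h0, h1, h⟩ := exists_lpNorm_one_transpose_mulVec_eq A hij
    exact ⟨x, h0, h1, h.symm⟩
  have hub : sSup S ∈ upperBounds {y : ℝ | ∃ x : Fin n → ℝ, (∑ i, x i) = 0 ∧ lpNorm 1 x = 1 ∧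
      y = lpNorm 1 (Aᵀ *ᵥ x)} := by
    rintro _ ⟨x, h0, h1, rfl⟩
    exact lpNorm_one_transpose_mulVec_le A hle h0 h1
  exact le_antisymm (csSup_le (hne.mono hsub) hub) (csSup_le_csSup ⟨_, hub⟩ hne hsub)

theorem sum_abs_lapMatrix_sub {n : ℕ} (G : SimpleGraph (Fin n)) [DecidableRel G.Adj]
    {i j : Fin n} (hij : i ≠ j) :
    ∑ k, |G.lapMatrix ℝ i k - G.lapMatrix ℝ j k| = 2 * ((G.degree i : ℝ) + (G.degree j : ℝ) -
      ((G.neighborFinset i ∩ G.neighborFinset j).card : ℝ)) := by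
  have h : ∀ k, |G.lapMatrix ℝ i k - G.lapMatrix ℝ j k| =
      (if k = i then (G.degree i : ℝ) else 0) + (if k = j then (G.degree j : ℝ) else 0) +
      (if k ∈ G.neighborFinset i then 1 else 0) + (if k ∈ G.neighborFinset j then 1 else 0) -
      2 * (if k ∈ G.neighborFinset i ∩ G.neighborFinset j then 1 else 0) := fun k => by
    simp only [SimpleGraph.lapMatrix, SimpleGraph.degMatrix, Matrix.sub_apply, diagonal_apply,
      SimpleGraph.adjMatrix_apply, Finset.mem_inter, SimpleGraph.mem_neighborFinset]
    by_cases hi : k = i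
    · subst hi
      rw [abs_of_nonneg] <;> by_cases hb : G.Adj j k <;> simp [hij, hij.symm, hb]
      positivity
    · by_cases hj : k = j
      · subst hj
        rw [abs_of_nonpos] <;> by_cases hb : G.Adj i k <;> simp [hij, hij.symm, hb]
        all_goals linarith [(Nat.cast_nonneg (G.degree k) : (0 : ℝ) ≤ _)]
      · by_cases ha : G.Adj i k <;> by_cases hb : G.Adj j k <;>
          simp [hi, hj, Ne.symm hi, Ne.symm hj, ha, hb]
        norm_num
  simp only [h, Finset.sum_add_distrib, Finset.sum_sub_distrib, ← Finset.mul_sum,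
    Finset.sum_ite_eq', Finset.mem_univ, if_true, Finset.sum_boole, Finset.filter_univ_mem,
    SimpleGraph.card_neighborFinset_eq_degree]
  ring

/-- Explicit formula for `τ₁` of the Laplacian matrix of a simple graph (Theorem 4.3). -/
theorem tau_one_lapMatrix {n : ℕ} (hn : 2 ≤ n) (G : SimpleGraph (Fin n))
    [DecidableRel G.Adj] :
    tau 1 (G.lapMatrix ℝ) =
      sSup {y : ℝ | ∃ i j : Fin n, i ≠ j ∧
        y = (G.degree i : ℝ) + (G.degree j : ℝ) -
          ((G.neighborFinset i ∩ G.neighborFinset j).card : ℝ)} := by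
  rw [tau_one_eq_sSup hn]
  congr 1
  ext y
  refine exists_congr fun i => exists_congr fun j => and_congr_right fun hij => ?_
  rw [sum_abs_lapMatrix_sub G hij, mul_div_cancel_left₀ _ two_ne_zero]
end
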